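/- arXiv:1904.09063 — 3 statements merged into one kernel-verified Lean document; each statement's English description precedes it below -/
import Mathlib

section
/- There are only finitely many tuples (t, A, x, y, z) of integers, all greater than 1, satisfying t(1 - 1/A²)(1 - 1/x²)(1 - 1/y²)(1 - 1/z²) = ((1 + 1/x)(1 + 1/y)(1 + 1/z))². -/
/-- The factor `(x+1)/(x-1)`. -/
def gfac (x : ℕ) : ℚ := 1 + 2 / ((x : ℚ) - 1)

theorem gfac_gt {x : ℕ} (hx : 2 ≤ x) : 1 < gfac x := by
  have h : (2 : ℚ) ≤ x := by exact_mod_cast hx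
  have : 0 < 2 / ((x : ℚ) - 1) := by apply div_pos <;> linarith
  unfold gfac; linarith

theorem gfac_lt {x y : ℕ} (hx : 2 ≤ x) (hxy : x < y) : gfac y < gfac x := by
  have h : (2 : ℚ) ≤ x := by exact_mod_cast hx
  have h' : (x : ℚ) < y := by exact_mod_cast hxy
  unfold gfac
  have : 2 / ((y : ℚ) - 1) < 2 / ((x : ℚ) - 1) := by
    apply div_lt_div_of_pos_left <;> linarith
  linarith

theorem gfac_le {x y : ℕ} (hx : 2 ≤ x) (hxy : x ≤ y) : gfac y ≤ gfac x := by
  rcases hxy.eq_or_lt with rfl | h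
  · exact le_rfl
  · exact (gfac_lt hx h).le

theorem gfac_le_three {x : ℕ} (hx : 2 ≤ x) : gfac x ≤ 3 := by
  have := gfac_le le_rfl hx
  have h2 : gfac 2 = 3 := by norm_num [gfac]
  linarith

def solSet (t : ℕ) : Set (ℕ × ℕ × ℕ × ℕ) :=
  {q | 2 ≤ q.1 ∧ 2 ≤ q.2.1 ∧ 2 ≤ q.2.2.1 ∧ 2 ≤ q.2.2.2 ∧
    (t : ℚ) * (1 - 1 / (q.1 : ℚ) ^ 2) = gfac q.2.1 * gfac q.2.2.1 * gfac q.2.2.2}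

theorem prod_aux {a b c a' b' c' : ℚ} (ha : 1 < a') (hb : 1 < b') (hc : 1 < c')
    (h1 : a' ≤ a) (h2 : b' ≤ b) (h3 : c' ≤ c) (h : a * b * c ≤ a' * b' * c') :
    a = a' ∧ b = b' ∧ c = c' := by
  have e1 : a' * b' ≤ a * b := by gcongr <;> linarith
  have p1 : 0 < a' * b' := by apply mul_pos <;> linarith
  have e2 : a' * b' * c ≤ a * b * c := by gcongr; linarith
  have hc' : c = c' := by nlinarith
  subst hc'
  have e3 : a * b ≤ a' * b' := le_of_mul_le_mul_right h (by linarith)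
  have hb' : b = b' := by nlinarith
  subst hb'
  have : a ≤ a' := le_of_mul_le_mul_right e3 (by linarith)
  exact ⟨le_antisymm this h1, rfl, rfl⟩

theorem gfac_inj {x y : ℕ} (hx : 2 ≤ x) (hxy : x ≤ y) (h : gfac x = gfac y) : x = y := by
  rcases hxy.eq_or_lt with rfl | h'
  · rfl
  · exact absurd (gfac_lt hx h') (by rw [h]; exact lt_irrefl _)

theorem solSet_finite (t : ℕ) (ht : 2 ≤ t) : (solSet t).Finite := by
  have hanti : IsAntichain (· ≤ ·) (solSet t) := by
    rintro ⟨A, x, y, z⟩ ⟨hA, hx, hy, hz, h⟩ ⟨A', x', y', z'⟩ ⟨hA', hx', hy', hz', h'⟩ hne hle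
    apply hne
    obtain ⟨lA, lx, ly, lz⟩ := hle
    dsimp only at *
    have tp : (0 : ℚ) < t := by exact_mod_cast (by omega : 0 < t)
    have Ap : (0 : ℚ) < A := by exact_mod_cast (by omega : 0 < A)
    have lA' : (A : ℚ) ≤ A' := by exact_mod_cast lA
    have e : (t : ℚ) * (1 - 1 / (A : ℚ) ^ 2) ≤ t * (1 - 1 / (A' : ℚ) ^ 2) := by
      gcongr
    rw [h, h'] at e
    obtain ⟨e1, e2, e3⟩ := prod_aux (gfac_gt hx') (gfac_gt hy') (gfac_gt hz')
      (gfac_le hx lx) (gfac_le hy ly) (gfac_le hz lz) e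
    obtain rfl := gfac_inj hx lx e1
    obtain rfl := gfac_inj hy ly e2
    obtain rfl := gfac_inj hz lz e3
    rw [← h'] at h
    have h4 := mul_left_cancel₀ tp.ne' h
    have h5 : ((A : ℚ) ^ 2) = (A' : ℚ) ^ 2 := by
      have : 1 / (A : ℚ) ^ 2 = 1 / (A' : ℚ) ^ 2 := by linarith
      simpa using this
    have h6 : A ^ 2 = A' ^ 2 := by exact_mod_cast h5
    have : A = A' := Nat.pow_left_injective (by norm_num : 2 ≠ 0) h6
    rw [this]
  exact WellQuasiOrderedLE.finite_of_isAntichain hanti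

theorem stmt_8 :
    {p : ℤ × ℤ × ℤ × ℤ × ℤ |
      1 < p.1 ∧ 1 < p.2.1 ∧ 1 < p.2.2.1 ∧ 1 < p.2.2.2.1 ∧ 1 < p.2.2.2.2 ∧
      (p.1 : ℚ) * (1 - 1/(p.2.1:ℚ)^2) * (1 - 1/(p.2.2.1:ℚ)^2) *
        (1 - 1/(p.2.2.2.1:ℚ)^2) * (1 - 1/(p.2.2.2.2:ℚ)^2) =
      ((1 + 1/(p.2.2.1:ℚ)) * (1 + 1/(p.2.2.2.1:ℚ)) * (1 + 1/(p.2.2.2.2:ℚ)))^2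
    }.Finite := by
  have hfin : (⋃ t ∈ Set.Icc 2 36, (fun q : ℕ × ℕ × ℕ × ℕ =>
      (((t : ℕ) : ℤ), ((q.1 : ℤ), ((q.2.1 : ℤ), ((q.2.2.1 : ℤ), (q.2.2.2 : ℤ)))))) ''
        solSet t).Finite := by
    apply Set.Finite.biUnion (Set.finite_Icc 2 36)
    intro t ht
    exact (solSet_finite t ht.1).image _
  refine hfin.subset ?_
  rintro ⟨t, A, x, y, z⟩ ⟨ht, hA, hx, hy, hz, h⟩
  dsimp only at *
  lift t to ℕ using by omega
  lift A to ℕ using by omega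
  lift x to ℕ using by omega
  lift y to ℕ using by omega
  lift z to ℕ using by omega
  have ht : 2 ≤ t := by omega
  have hA : 2 ≤ A := by omega
  have hx : 2 ≤ x := by omega
  have hy : 2 ≤ y := by omega
  have hz : 2 ≤ z := by omega
  simp only [Int.cast_natCast] at h
  have key : ∀ w : ℕ, 2 ≤ w → (1 + 1 / (w : ℚ)) ^ 2 = gfac w * (1 - 1 / (w : ℚ) ^ 2) ∧
      0 < 1 - 1 / (w : ℚ) ^ 2 := by
    intro w hw
    have hw' : (2 : ℚ) ≤ w := by exact_mod_cast hw
    have h1 : (w : ℚ) - 1 ≠ 0 := by intro h; linarith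
    have h0 : (w : ℚ) ≠ 0 := by intro h; linarith
    refine ⟨?_, ?_⟩
    · unfold gfac; field_simp; ring
    · rw [sub_pos, div_lt_one (by positivity)]; nlinarith
  obtain ⟨kx, px⟩ := key x hx
  obtain ⟨ky, py⟩ := key y hy
  obtain ⟨kz, pz⟩ := key z hz
  have main : (t : ℚ) * (1 - 1 / (A : ℚ) ^ 2) = gfac x * gfac y * gfac z := by
    rw [mul_pow, mul_pow, kx, ky, kz] at h
    apply mul_right_cancel₀ (mul_pos (mul_pos px py) pz).ne'
    linear_combination h
  have hb : t ≤ 36 := by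
    have g1 : gfac x * gfac y * gfac z ≤ 3 * 3 * 3 := by
      have := gfac_gt hx
      have := gfac_gt hy
      have := gfac_gt hz
      gcongr
      · exact gfac_le_three hx
      · exact gfac_le_three hy
      · exact gfac_le_three hz
    have hA' : (2 : ℚ) ≤ A := by exact_mod_cast hA
    have g2 : 1 / (A : ℚ) ^ 2 ≤ 1 / 2 ^ 2 := by gcongr
    have tp : (0 : ℚ) ≤ t := by positivity
    have : (t : ℚ) ≤ 36 := by nlinarith
    exact_mod_cast this
  simp only [Set.mem_iUnion]
  exact ⟨t, ⟨ht, hb⟩, (A, x, y, z), ⟨hA, hx, hy, hz, main⟩, rfl⟩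
end

section
/- If t, A, x, y, z are integers with t ≥ 2, 1 < t < A < x < y < z, satisfying t(1 - 1/A²)(1 - 1/x²)(1 - 1/y²)(1 - 1/z²) = ((1 + 1/x)(1 + 1/y)(1 + 1/z))², then t = 2. -/
theorem stmt_10 (t A x y z : ℤ) (ht2 : 2 ≤ t) (ht : 1 < t) (htA : t < A)
    (hAx : A < x) (hxy : x < y) (hyz : y < z)
    (heq : (t : ℚ) * (1 - 1/(A:ℚ)^2) * (1 - 1/(x:ℚ)^2) * (1 - 1/(y:ℚ)^2) *
        (1 - 1/(z:ℚ)^2) =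
      ((1 + 1/(x:ℚ)) * (1 + 1/(y:ℚ)) * (1 + 1/(z:ℚ)))^2) :
    t = 2 := by
  by_contra hne
  have h3 : 3 ≤ t := by omega
  have hT : (3:ℚ) ≤ t := by exact_mod_cast h3
  have hA : (4:ℚ) ≤ A := by exact_mod_cast (by omega : 4 ≤ A)
  have hx : (5:ℚ) ≤ x := by exact_mod_cast (by omega : 5 ≤ x)
  have hy : (6:ℚ) ≤ y := by exact_mod_cast (by omega : 6 ≤ y)
  have hz : (7:ℚ) ≤ z := by exact_mod_cast (by omega : 7 ≤ z)
  clear hne h3 ht2 ht htA hAx hxy hyz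
  generalize (t:ℚ) = T at *
  generalize (A:ℚ) = a at *
  generalize (x:ℚ) = p at *
  generalize (y:ℚ) = q at *
  generalize (z:ℚ) = r at *
  have key : ∀ u c : ℚ, 1 < c → c ≤ u →
      (1 + 1/u)^2 ≤ (c+1)/(c-1) * (1 - 1/u^2) ∧ 0 < 1 - 1/u^2 := by
    intro u c hc hu
    have hu0 : 0 < u := by linarith
    have hi : 0 < 1/u := by positivity
    have hi1 : 1/u ≤ 1/c := one_div_le_one_div_of_le (by linarith) hu
    have hic : 1/c < 1 := by rw [div_lt_one (by linarith)]; exact hc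
    have e : 1/u^2 = (1/u)^2 := by rw [one_div_pow]
    have hcw : c * (1/u) ≤ 1 := by
      rw [mul_one_div, div_le_one hu0]; exact hu
    rw [e]
    generalize 1/u = w at *
    refine ⟨?_, by nlinarith⟩
    rw [div_mul_eq_mul_div, le_div_iff₀ (by linarith)]
    have : 0 ≤ (1 + w) * (1 - c * w) := mul_nonneg (by linarith) (by linarith)
    nlinarith
  obtain ⟨p1, p2⟩ := key p 5 (by norm_num) hx
  obtain ⟨q1, q2⟩ := key q 6 (by norm_num) hy
  obtain ⟨r1, r2⟩ := key r 7 (by norm_num) hz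
  have ha : 1/a^2 ≤ 1/16 := one_div_le_one_div_of_le (by norm_num) (by nlinarith)
  have hl : 45/16 ≤ T * (1 - 1/a^2) := by nlinarith
  rw [mul_pow, mul_pow] at heq
  have m1 := mul_le_mul p1 q1 (by positivity) (by positivity)
  have m2 := mul_le_mul m1 r1 (by positivity) (by positivity)
  have hP : 0 < (1 - 1/p^2) * (1 - 1/q^2) * (1 - 1/r^2) := by positivity
  have m3 := mul_le_mul_of_nonneg_right hl hP.le
  rw [← heq] at m2
  norm_num at m2 m3 hP
  nlinarith
end

section
/- Let b ≥ 2 be a positive integer, set a = 2 - b², and let n be a positive integer such that a + 1, a + 2, …, a + n are all nonzero and a + n ≠ 1. Then (1 - 1/(2b+1)²)(1 - 1/(2b-1)²)(1 - 1/(2a+2n-1)²)·∏_{i=0}^{n} (1 - 1/(a-1+i)²) = ((1 - 1/(2b+1))(1 + 1/(2b-1))(1 + 1/(2a+2n-1)))². -/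
theorem tele_aux (a : ℤ) (k : ℕ) (h : a + k < 0) :
    (∏ i ∈ Finset.range (k + 1), (1 - 1/((a - 1 + (i : ℤ) : ℤ) : ℝ)^2)) =
      ((a:ℝ) - 2) * (a + k) / ((a - 1) * (a - 1 + k)) := by
  induction k with
  | zero =>
    have h1 : (a:ℝ) - 1 ≠ 0 := by
      have : a - 1 ≠ 0 := by push_cast at h; omega
      exact_mod_cast this
    simp
    field_simp
    ring
  | succ k ih =>
    rw [Finset.prod_range_succ, ih (by push_cast at h; omega)]
    have h1 : (a:ℝ) - 1 ≠ 0 := by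
      have : a - 1 ≠ 0 := by push_cast at h; omega
      exact_mod_cast this
    have h2 : (a:ℝ) - 1 + k ≠ 0 := by
      have : a - 1 + k ≠ 0 := by push_cast at h; omega
      exact_mod_cast this
    have h3 : (a:ℝ) + k ≠ 0 := by
      have : a + k ≠ 0 := by push_cast at h; omega
      exact_mod_cast this
    have e : (a:ℝ) - 1 + (k + 1) = a + k := by ring
    push_cast
    rw [e]
    field_simp
    ring

theorem stmt_14 (b : ℤ) (hb : 2 ≤ b) (a : ℤ) (ha : a = 2 - b^2)
    (n : ℤ) (hn : 1 ≤ n)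
    (hnz : ∀ i : ℤ, 1 ≤ i → i ≤ n → a + i ≠ 0) (han : a + n ≠ 1) :
    (1 - 1/((2*b+1 : ℤ) : ℝ)^2) * (1 - 1/((2*b-1 : ℤ) : ℝ)^2) *
      (1 - 1/((2*a+2*n-1 : ℤ) : ℝ)^2) *
      (∏ i ∈ Finset.range (n.toNat + 1), (1 - 1/((a - 1 + (i : ℤ) : ℤ) : ℝ)^2)) =
    ((1 - 1/((2*b+1 : ℤ) : ℝ)) * (1 + 1/((2*b-1 : ℤ) : ℝ)) *
      (1 + 1/((2*a+2*n-1 : ℤ) : ℝ)))^2 := by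
  have ha2 : a ≤ -2 := by nlinarith
  have hneg : a + n < 0 := by
    by_contra hc
    exact hnz (-a) (by omega) (by omega) (by omega)
  lift n to ℕ using (by omega) with k
  rw [Int.toNat_natCast, tele_aux a k hneg]
  have haR : (a:ℝ) = 2 - (b:ℝ)^2 := by rw [ha]; push_cast; ring
  obtain ⟨m, hm⟩ : ∃ m : ℤ, m = a + k := ⟨_, rfl⟩
  have hmR : (k:ℝ) = m - a := by rw [hm]; push_cast; ring
  have h1 : 2 * (b:ℝ) + 1 ≠ 0 := by
    have : 2 * b + 1 ≠ 0 := by omega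
    exact_mod_cast this
  have h2 : 2 * (b:ℝ) - 1 ≠ 0 := by
    have : 2 * b - 1 ≠ 0 := by omega
    exact_mod_cast this
  have h3 : 2 * (m:ℝ) - 1 ≠ 0 := by
    have : 2 * m - 1 ≠ 0 := by omega
    exact_mod_cast this
  have h4 : (m:ℝ) - 1 ≠ 0 := by
    have : m - 1 ≠ 0 := by omega
    exact_mod_cast this
  have h5 : 1 - (b:ℝ)^2 ≠ 0 := by
    have : 1 - b^2 ≠ 0 := by omega
    exact_mod_cast this
  push_cast
  rw [hmR, haR]
  have e1 : 2 * (2 - (b:ℝ)^2) + 2 * (m - (2 - (b:ℝ)^2)) - 1 = 2 * m - 1 := by ring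
  have e2 : 2 - (b:ℝ)^2 - 1 + (m - (2 - (b:ℝ)^2)) = m - 1 := by ring
  have e3 : 2 - (b:ℝ)^2 + (m - (2 - (b:ℝ)^2)) = m := by ring
  have e4 : 2 - (b:ℝ)^2 - 1 = 1 - (b:ℝ)^2 := by ring
  rw [e1, e2, e3, e4]
  field_simp
  ring
end
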